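/- For every finitely supported function f : ℤ_{≥0} → ℂ (written f(q^{2k})): (1 − q^{2n}) Σ_{k=0}^{∞} |f(q^{2k})|² q^{−2nk} (q^{2k+2};q²)_{n−1} = [h / (4π(1 − q^{2n}))] · ∫_0^{2π/h} |𝓕f(ρ)|² dρ / |c(ρ)|² (the Plancherel formula for the q-spherical transform). -/

import Mathlib

/-- The q²-shifted factorial `(a; q²)_m = ∏_{j=0}^{m-1} (1 − a q^{2j})`. -/
noncomputable def qpochC (q : ℝ) (a : ℂ) (m : ℕ) : ℂ :=
  ∏ j ∈ Finset.range m, (1 - a * (q : ℂ) ^ (2 * j))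

/-- The infinite q²-shifted factorial `(a; q²)_∞ = ∏_{j=0}^{∞} (1 − a q^{2j})`. -/
noncomputable def qpochCInf (q : ℝ) (a : ℂ) : ℂ :=
  ∏' j : ℕ, (1 - a * (q : ℂ) ^ (2 * j))

/-- `q^z = e^{z·ln q}` for complex `z`. -/
noncomputable def qcpow (q : ℝ) (z : ℂ) : ℂ := Complex.exp (z * Real.log q)

/-- The q-spherical function `φ_ρ(q^{2m})`. -/
noncomputable def sphPhi (q : ℝ) (n : ℕ) (ρ : ℝ) (m : ℕ) : ℂ :=
  ∑ l ∈ Finset.range (m + 1),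
    qpochC q (((q : ℂ) ^ (2 * m))⁻¹) l *
      qpochC q (qcpow q ((n : ℂ) + ρ * Complex.I)) l *
      qpochC q (qcpow q ((n : ℂ) - ρ * Complex.I)) l /
      (qpochC q ((q : ℂ) ^ (2 * n)) l * qpochC q ((q : ℂ) ^ 2) l) * (q : ℂ) ^ (2 * l)

/-- The q-spherical transform
`𝓕f(ρ) = (1 − q^{2n}) Σ_{k≥0} f(q^{2k}) φ_ρ(q^{2k}) q^{−2nk} (q^{2k+2};q²)_{n−1}`. -/
noncomputable def sphT (q : ℝ) (n : ℕ) (f : ℕ → ℂ) (ρ : ℝ) : ℂ :=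
  (1 - (q : ℂ) ^ (2 * n)) *
    ∑' k : ℕ, f k * sphPhi q n ρ k * ((q : ℂ) ^ (2 * n * k))⁻¹ *
      qpochC q ((q : ℂ) ^ (2 * k + 2)) (n - 1)

/-- The q-Harish-Chandra density
`1/|c(ρ)|² = (q^{2n};q²)_∞² (q^{2iρ};q²)_∞ (q^{−2iρ};q²)_∞
  / [(q^{n+iρ};q²)_∞² (q^{n−iρ};q²)_∞²]`. -/
noncomputable def cInv (q : ℝ) (n : ℕ) (ρ : ℝ) : ℂ :=
  (qpochCInf q ((q : ℂ) ^ (2 * n))) ^ 2 *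
    qpochCInf q (qcpow q (2 * ρ * Complex.I)) *
    qpochCInf q (qcpow q (-(2 * ρ * Complex.I))) /
    ((qpochCInf q (qcpow q ((n : ℂ) + ρ * Complex.I))) ^ 2 *
      (qpochCInf q (qcpow q ((n : ℂ) - ρ * Complex.I))) ^ 2)

section qPochhammer

variable {q : ℝ}

lemma qpochC_zero (a : ℂ) : qpochC q a 0 = 1 := by simp [qpochC]

lemma qpochC_succ (a : ℂ) (m : ℕ) :
    qpochC q a (m + 1) = qpochC q a m * (1 - a * (q : ℂ) ^ (2 * m)) := by
  simp [qpochC, Finset.prod_range_succ]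

lemma qpochC_add (a : ℂ) (m k : ℕ) :
    qpochC q a (m + k) = qpochC q a m * qpochC q (a * (q : ℂ) ^ (2 * m)) k := by
  simp only [qpochC, Finset.prod_range_add]
  congr 1
  refine Finset.prod_congr rfl fun j _ ↦ ?_
  ring

lemma qpochC_succ' (a : ℂ) (m : ℕ) :
    qpochC q a (m + 1) = (1 - a) * qpochC q (a * (q : ℂ) ^ 2) m := by
  rw [add_comm, qpochC_add]
  simp [qpochC]

lemma qpochC_conj (a : ℂ) (m : ℕ) :
    (starRingEnd ℂ) (qpochC q a m) = qpochC q ((starRingEnd ℂ) a) m := by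
  simp [qpochC, map_prod]

lemma continuous_qpochC (m : ℕ) : Continuous fun a ↦ qpochC q a m := by
  unfold qpochC
  fun_prop

lemma norm_q_pow (hq0 : 0 < q) (k : ℕ) : ‖(q : ℂ) ^ k‖ = q ^ k := by
  rw [norm_pow, Complex.norm_real, Real.norm_of_nonneg hq0.le]

lemma one_sub_ne_zero_of_norm_lt {a : ℂ} (ha : ‖a‖ < 1) : 1 - a ≠ 0 := by
  intro h
  rw [sub_eq_zero] at h
  simp [← h] at ha

variable (hq0 : 0 < q) (hq1 : q < 1)
include hq0 hq1

lemma norm_mul_q_pow_lt {a : ℂ} (ha : ‖a‖ < 1) (k : ℕ) : ‖a * (q : ℂ) ^ k‖ < 1 := by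
  rw [norm_mul, norm_q_pow hq0]
  exact (mul_le_of_le_one_right (norm_nonneg _) (pow_le_one₀ hq0.le hq1.le)).trans_lt ha

lemma norm_q_pow_lt {k : ℕ} (hk : k ≠ 0) : ‖(q : ℂ) ^ k‖ < 1 := by
  rw [norm_q_pow hq0]
  exact pow_lt_one₀ hq0.le hq1 hk

lemma qpochC_ne_zero {a : ℂ} (ha : ‖a‖ < 1) (m : ℕ) : qpochC q a m ≠ 0 :=
  Finset.prod_ne_zero_iff.2 fun _ _ ↦
    one_sub_ne_zero_of_norm_lt (norm_mul_q_pow_lt hq0 hq1 ha _)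

lemma summable_norm_q_pow (a : ℂ) : Summable fun j : ℕ ↦ ‖-(a * (q : ℂ) ^ (2 * j))‖ := by
  simp_rw [norm_neg, norm_mul, norm_q_pow hq0, pow_mul]
  exact (summable_geometric_of_lt_one (by positivity) (pow_lt_one₀ hq0.le hq1 two_ne_zero)).mul_left _

lemma multipliable_qpochCInf (a : ℂ) : Multipliable fun j : ℕ ↦ 1 - a * (q : ℂ) ^ (2 * j) := by
  simpa [sub_eq_add_neg] using multipliable_one_add_of_summable (summable_norm_q_pow hq0 hq1 a)

lemma tendsto_qpochC (a : ℂ) :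
    Filter.Tendsto (fun m ↦ qpochC q a m) Filter.atTop (nhds (qpochCInf q a)) :=
  (multipliable_qpochCInf hq0 hq1 a).hasProd.tendsto_prod_nat

lemma qpochCInf_eq (a : ℂ) (m : ℕ) :
    qpochCInf q a = qpochC q a m * qpochCInf q (a * (q : ℂ) ^ (2 * m)) := by
  have h := (tendsto_qpochC hq0 hq1 (a * (q : ℂ) ^ (2 * m))).const_mul (qpochC q a m)
  simp_rw [← qpochC_add] at h
  refine tendsto_nhds_unique ?_ h
  simpa [add_comm] using (Filter.tendsto_add_atTop_iff_nat m).2 (tendsto_qpochC hq0 hq1 a)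

lemma qpochCInf_eq_one_sub_mul (a : ℂ) :
    qpochCInf q a = (1 - a) * qpochCInf q (a * (q : ℂ) ^ 2) := by
  simpa [qpochC] using qpochCInf_eq hq0 hq1 a 1

lemma qpochCInf_ne_zero {a : ℂ} (ha : ‖a‖ < 1) : qpochCInf q a ≠ 0 := by
  simp_rw [qpochCInf, sub_eq_add_neg]
  refine tprod_one_add_ne_zero_of_summable (fun i ↦ ?_) (summable_norm_q_pow hq0 hq1 a)
  rw [← sub_eq_add_neg]
  exact one_sub_ne_zero_of_norm_lt (norm_mul_q_pow_lt hq0 hq1 ha _)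

omit hq0 hq1 in
lemma qpochCInf_zero : qpochCInf q 0 = 1 := by simp [qpochCInf]

lemma differentiable_qpochCInf : Differentiable ℂ fun a ↦ qpochCInf q a := by
  intro a
  have hprod : HasProdLocallyUniformlyOn (fun (j : ℕ) (a : ℂ) ↦ 1 + -(a * (q : ℂ) ^ (2 * j)))
      (fun a ↦ ∏' j : ℕ, (1 + -(a * (q : ℂ) ^ (2 * j)))) (Metric.ball 0 (‖a‖ + 1)) := by
    refine Summable.hasProdLocallyUniformlyOn_nat_one_add Metric.isOpen_ball
      (summable_norm_q_pow hq0 hq1 ((‖a‖ + 1 : ℝ) : ℂ)) (.of_forall fun j x hx ↦ ?_)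
      fun j ↦ by fun_prop
    simp only [norm_neg, norm_mul]
    gcongr
    rw [Complex.norm_real, Real.norm_of_nonneg (by positivity)]
    exact (mem_ball_zero_iff.1 hx).le
  have h := hprod.differentiableOn (.of_forall fun s ↦ by
    simpa [Finset.prod_fn] using DifferentiableOn.finsetProd (fun _ _ ↦ by fun_prop))
    Metric.isOpen_ball
  simp_rw [← sub_eq_add_neg] at h
  exact h.differentiableAt (Metric.isOpen_ball.mem_nhds (by simp))

end qPochhammer

section circleAverage

open Real Metric

lemma circleAverage_comp_mul_eq_of_differentiableAt_annulus {h : ℂ → ℂ} {r R : ℝ} (hr : 0 < r)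
    (hrR : r ≤ R) (hd : ∀ z, r ≤ ‖z‖ → ‖z‖ ≤ R → DifferentiableAt ℂ h z) :
    circleAverage (fun z ↦ h (r * z)) 0 1 = circleAverage (fun z ↦ h (R * z)) 0 1 := by
  have key := Complex.circleIntegral_sub_center_inv_smul_eq_of_differentiable_on_annulus_off_countable
    (c := 0) (f := h) hr hrR Set.countable_empty
    (fun z hz ↦ (hd z (by simpa using hz.2) (by simpa using hz.1)).continuousAt.continuousWithinAt)
    (fun z hz ↦ hd z (by simpa using (not_le.1 (by simpa using hz.1.2)).le)
      (mem_ball_zero_iff.1 hz.1.1).le)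
  have hav (s : ℝ) : circleAverage (fun z ↦ h (s * z)) 0 1 = circleAverage h 0 s := by
    rw [circleAverage_eq_circleAverage_zero_one (f := h)]
    simp
  rw [hav, hav, circleAverage_eq_circleIntegral hr.ne',
    circleAverage_eq_circleIntegral (hr.trans_le hrR).ne', key]

lemma circleIntegrable_zero_one {f : ℂ → ℂ} (hf : ∀ z, ‖z‖ = 1 → ContinuousAt f z) :
    CircleIntegrable f 0 1 :=
  ContinuousOn.circleIntegrable zero_le_one fun z hz ↦
    (hf z (by simpa using hz)).continuousWithinAt

lemma circleAverage_zero_one_congr {f g : ℂ → ℂ} (hfg : ∀ z, ‖z‖ = 1 → f z = g z) :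
    circleAverage f 0 1 = circleAverage g 0 1 :=
  circleAverage_congr_sphere fun z hz ↦ hfg z (by simpa using hz)

lemma circleAverage_const_mul (c : ℂ) (f : ℂ → ℂ) :
    circleAverage (fun z ↦ c * f z) 0 1 = c * circleAverage f 0 1 := by
  simpa using circleAverage_fun_smul (a := c) (f := f) (c := 0) (R := 1)

/-- Continuity of circle averages in a parameter `t ∈ [0, 1]`. -/
lemma tendsto_circleAverage_of_continuousOn {F : ℝ → ℂ → ℂ} {u : ℕ → ℝ}
    (hF : ∀ t z, t ∈ Set.Icc (0 : ℝ) 1 → ‖z‖ = 1 → ContinuousAt (fun p : ℝ × ℂ ↦ F p.1 p.2) (t, z))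
    (hu : ∀ N, u N ∈ Set.Icc (0 : ℝ) 1) (hu0 : Filter.Tendsto u Filter.atTop (nhds 0)) :
    Filter.Tendsto (fun N ↦ circleAverage (F (u N)) 0 1) Filter.atTop
      (nhds (circleAverage (F 0) 0 1)) := by
  have hcont : Continuous fun t : Set.Icc (0 : ℝ) 1 ↦
      ∫ θ in 0..2 * π, F (t : ℝ) (circleMap 0 1 θ) := by
    refine intervalIntegral.continuous_parametric_intervalIntegral_of_continuous' ?_ _ _
    rw [continuous_iff_continuousAt]
    rintro ⟨t, θ⟩
    have hmap : Continuous fun p : Set.Icc (0 : ℝ) 1 × ℝ ↦ ((p.1 : ℝ), circleMap 0 1 p.2) :=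
      (continuous_subtype_val.comp continuous_fst).prodMk
        ((continuous_circleMap 0 1).comp continuous_snd)
    exact ContinuousAt.comp (f := fun p : Set.Icc (0 : ℝ) 1 × ℝ ↦ ((p.1 : ℝ), circleMap 0 1 p.2))
      (g := fun p : ℝ × ℂ ↦ F p.1 p.2) (x := (t, θ)) (hF t (circleMap 0 1 θ) t.2 (by simp))
      hmap.continuousAt
  have h0 : (0 : ℝ) ∈ Set.Icc (0 : ℝ) 1 := by simp
  have hlim : Filter.Tendsto (fun N ↦ (⟨u N, hu N⟩ : Set.Icc (0 : ℝ) 1)) Filter.atTop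
      (nhds ⟨0, h0⟩) := tendsto_subtype_rng.2 hu0
  simp_rw [circleAverage_def]
  exact ((hcont.tendsto ⟨0, h0⟩).comp hlim).const_smul _

end circleAverage

section AlSalamChihara

open Real

/-- The weight `(z², z⁻²; q²)_∞ / (az, a/z, bz, b/z; q²)_∞` of the Al-Salam–Chihara polynomials. -/
noncomputable def alSalamChiharaWeight (q : ℝ) (a b z : ℂ) : ℂ :=
  qpochCInf q (z ^ 2) * qpochCInf q (z⁻¹ ^ 2) /
    (qpochCInf q (a * z) * qpochCInf q (a * z⁻¹) * qpochCInf q (b * z) * qpochCInf q (b * z⁻¹))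

variable {q : ℝ} (hq0 : 0 < q) (hq1 : q < 1)
include hq0 hq1

lemma continuous_qpochCInf : Continuous fun a ↦ qpochCInf q a :=
  (differentiable_qpochCInf hq0 hq1).continuous

omit hq0 hq1 in
lemma alSalamChiharaWeight_comm (a b z : ℂ) :
    alSalamChiharaWeight q a b z = alSalamChiharaWeight q b a z := by
  unfold alSalamChiharaWeight
  ring

lemma continuousAt_alSalamChiharaWeight {a b z : ℂ} (ha : ‖a‖ < 1) (hb : ‖b‖ < 1) (hz : ‖z‖ = 1) :
    ContinuousAt (alSalamChiharaWeight q a b) z := by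
  have hP := continuous_qpochCInf hq0 hq1
  have hz0 : z ≠ 0 := norm_ne_zero_iff.1 (by simp [hz])
  have hinv : ContinuousAt (fun z : ℂ ↦ z⁻¹) z := continuousAt_inv₀ hz0
  refine ContinuousAt.div ?_ ?_ ?_
  · exact (hP.continuousAt.comp (by fun_prop)).mul
      (hP.continuousAt.comp (f := fun z : ℂ ↦ z⁻¹ ^ 2) (by fun_prop))
  · exact (((hP.continuousAt.comp (by fun_prop)).mul
      (hP.continuousAt.comp (f := fun z : ℂ ↦ a * z⁻¹) (by fun_prop))).mul
      (hP.continuousAt.comp (by fun_prop))).mul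
      (hP.continuousAt.comp (f := fun z : ℂ ↦ b * z⁻¹) (by fun_prop))
  · have := @qpochCInf_ne_zero q hq0 hq1
    refine mul_ne_zero (mul_ne_zero (mul_ne_zero ?_ ?_) ?_) ?_ <;> apply this <;> simpa [hz]

/-- The function whose `q`-difference gives the shift relation for the total mass. -/
private noncomputable def shiftKernel (q : ℝ) (a b z : ℂ) : ℂ :=
  -z * qpochCInf q (q ^ 2 * z ^ 2) * qpochCInf q (z⁻¹ ^ 2) /
    (qpochCInf q (a * q * z) * qpochCInf q (a * q * z⁻¹) * qpochCInf q (b * q * z) *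
      qpochCInf q (b * q * z⁻¹))

private lemma differentiableAt_shiftKernel {a b z : ℂ} (ha : ‖a‖ < 1) (hb : ‖b‖ < 1)
    (h1 : q ≤ ‖z‖) (h2 : ‖z‖ ≤ q⁻¹) : DifferentiableAt ℂ (shiftKernel q a b) z := by
  have hP := differentiable_qpochCInf hq0 hq1
  have hzpos : 0 < ‖z‖ := hq0.trans_le h1
  have hz0 : z ≠ 0 := norm_pos_iff.1 hzpos
  have hinv : DifferentiableAt ℂ (fun z : ℂ ↦ z⁻¹) z := differentiableAt_inv hz0
  have hb1 : q * ‖z‖ ≤ 1 := by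
    calc q * ‖z‖ ≤ q * q⁻¹ := by gcongr
      _ = 1 := mul_inv_cancel₀ hq0.ne'
  have hb2 : q * ‖z‖⁻¹ ≤ 1 := by
    rw [← div_eq_mul_inv]
    exact (div_le_one hzpos).2 h1
  have hn1 {c : ℂ} (hc : ‖c‖ < 1) : ‖c * q * z‖ < 1 := by
    rw [norm_mul, norm_mul, Complex.norm_real, norm_of_nonneg hq0.le, mul_assoc]
    exact (mul_le_of_le_one_right (norm_nonneg _) hb1).trans_lt hc
  have hn2 {c : ℂ} (hc : ‖c‖ < 1) : ‖c * q * z⁻¹‖ < 1 := by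
    rw [norm_mul, norm_mul, Complex.norm_real, norm_of_nonneg hq0.le, mul_assoc, norm_inv]
    exact (mul_le_of_le_one_right (norm_nonneg _) hb2).trans_lt hc
  have hc1 (c : ℂ) : DifferentiableAt ℂ (fun z ↦ qpochCInf q (c * z)) z :=
    (hP _).comp z (by fun_prop)
  have hc2 (c : ℂ) : DifferentiableAt ℂ (fun z ↦ qpochCInf q (c * z⁻¹)) z :=
    DifferentiableAt.comp (f := fun z : ℂ ↦ c * z⁻¹) z (hP _) (by fun_prop)
  refine DifferentiableAt.div ?_ ((((hc1 _).mul (hc2 _)).mul (hc1 _)).mul (hc2 _)) ?_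
  · refine (differentiableAt_id.neg.mul ((hP _).comp z (by fun_prop))).mul ?_
    exact DifferentiableAt.comp (f := fun z : ℂ ↦ z⁻¹ ^ 2) z (hP _) (by fun_prop)
  · have := @qpochCInf_ne_zero q hq0 hq1
    exact mul_ne_zero (mul_ne_zero (mul_ne_zero (this (hn1 ha)) (this (hn2 ha))) (this (hn1 hb)))
      (this (hn2 hb))

private lemma alSalamChiharaWeight_shift {a b z : ℂ} (ha : ‖a‖ < 1) (hb : ‖b‖ < 1) (hz : ‖z‖ = 1) :
    alSalamChiharaWeight q (a * q ^ 2) b z = (1 - a * b) * alSalamChiharaWeight q a b z -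
      a * q * (shiftKernel q a b (q * z) - shiftKernel q a b ((q⁻¹ : ℝ) * z)) := by
  have hz0 : z ≠ 0 := norm_ne_zero_iff.1 (by simp [hz])
  have hq : (q : ℂ) ≠ 0 := by exact_mod_cast hq0.ne'
  have hP := qpochCInf_eq_one_sub_mul hq0 hq1
  have hne := @qpochCInf_ne_zero q hq0 hq1
  have hlt := @norm_mul_q_pow_lt q hq0 hq1
  have e1 := hP (a * z)
  have e2 := hP (a * z⁻¹)
  have e3 := hP (b * z)
  have e4 := hP (b * z⁻¹)
  have e5 := hP (z ^ 2)
  have e6 := hP (z ^ 2 * q ^ 2)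
  have e7 := hP (z⁻¹ ^ 2)
  have e8 := hP ((z⁻¹ * (q : ℂ)⁻¹) ^ 2)
  rw [show (z⁻¹ * (q : ℂ)⁻¹) ^ 2 * (q : ℂ) ^ 2 = z⁻¹ ^ 2 by field_simp] at e8
  have n1 : 1 - a * z ≠ 0 := one_sub_ne_zero_of_norm_lt (by simpa [hz])
  have n2 : 1 - a * z⁻¹ ≠ 0 := one_sub_ne_zero_of_norm_lt (by simpa [hz])
  have n3 : 1 - b * z ≠ 0 := one_sub_ne_zero_of_norm_lt (by simpa [hz])
  have n4 : 1 - b * z⁻¹ ≠ 0 := one_sub_ne_zero_of_norm_lt (by simpa [hz])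
  have m1 := hne (hlt (a := a * z) (by simpa [hz]) 2)
  have m2 := hne (hlt (a := a * z⁻¹) (by simpa [hz]) 2)
  have m3 := hne (hlt (a := b * z) (by simpa [hz]) 2)
  have m4 := hne (hlt (a := b * z⁻¹) (by simpa [hz]) 2)
  unfold alSalamChiharaWeight shiftKernel
  rw [show a * (q : ℂ) ^ 2 * z = a * z * q ^ 2 by ring,
    show a * (q : ℂ) ^ 2 * z⁻¹ = a * z⁻¹ * q ^ 2 by ring,
    show (q : ℂ) ^ 2 * (q * z) ^ 2 = z ^ 2 * q ^ 2 * q ^ 2 by ring,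
    show ((q : ℂ) * z)⁻¹ = z⁻¹ * (q : ℂ)⁻¹ by rw [mul_inv, mul_comm],
    show a * (q : ℂ) * (q * z) = a * z * q ^ 2 by ring,
    show b * (q : ℂ) * (q * z) = b * z * q ^ 2 by ring,
    show a * (q : ℂ) * (z⁻¹ * (q : ℂ)⁻¹) = a * z⁻¹ by field_simp,
    show b * (q : ℂ) * (z⁻¹ * (q : ℂ)⁻¹) = b * z⁻¹ by field_simp]
  push_cast
  rw [show (q : ℂ) ^ 2 * ((q : ℂ)⁻¹ * z) ^ 2 = z ^ 2 by field_simp,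
    show ((q : ℂ)⁻¹ * z)⁻¹ = z⁻¹ * q by rw [mul_inv, inv_inv, mul_comm],
    show (z⁻¹ * (q : ℂ)) ^ 2 = z⁻¹ ^ 2 * q ^ 2 by ring,
    show a * (q : ℂ) * ((q : ℂ)⁻¹ * z) = a * z by field_simp,
    show b * (q : ℂ) * ((q : ℂ)⁻¹ * z) = b * z by field_simp,
    show a * (q : ℂ) * (z⁻¹ * q) = a * z⁻¹ * q ^ 2 by ring,
    show b * (q : ℂ) * (z⁻¹ * q) = b * z⁻¹ * q ^ 2 by ring,
    e8, e7, e5, e6, e1, e2, e3, e4]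
  generalize qpochCInf q (a * z * q ^ 2) = A1 at *
  generalize qpochCInf q (a * z⁻¹ * q ^ 2) = A2 at *
  generalize qpochCInf q (b * z * q ^ 2) = A3 at *
  generalize qpochCInf q (b * z⁻¹ * q ^ 2) = A4 at *
  generalize qpochCInf q (z ^ 2 * q ^ 2 * q ^ 2) = B1 at *
  generalize qpochCInf q (z⁻¹ ^ 2 * q ^ 2) = B2 at *
  clear e1 e2 e3 e4 e5 e6 e7 e8
  have n2' : z - a ≠ 0 := by
    intro h; apply n2; rw [sub_eq_zero] at h; simp [← h, hz0]
  have n4' : z - b ≠ 0 := by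
    intro h; apply n4; rw [sub_eq_zero] at h; simp [← h, hz0]
  rw [show 1 - a * z⁻¹ = (z - a) / z by field_simp, show 1 - b * z⁻¹ = (z - b) / z by field_simp]
  rw [mul_comm] at n1 n3
  field_simp
  ring

lemma circleAverage_alSalamChiharaWeight_mul_sq {a b : ℂ} (ha : ‖a‖ < 1) (hb : ‖b‖ < 1) :
    circleAverage (alSalamChiharaWeight q (a * q ^ 2) b) 0 1 =
      (1 - a * b) * circleAverage (alSalamChiharaWeight q a b) 0 1 := by
  have hqq : q ≤ q⁻¹ := hq1.le.trans ((one_le_inv₀ hq0).2 hq1.le)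
  have hd (z : ℂ) := differentiableAt_shiftKernel hq0 hq1 (z := z) ha hb
  have hshift := circleAverage_comp_mul_eq_of_differentiableAt_annulus hq0 hqq hd
  have hcont (r : ℝ) (hr0 : 0 < r) (hr : q ≤ r) (hr' : r ≤ q⁻¹) :
      CircleIntegrable (fun z ↦ shiftKernel q a b (r * z)) 0 1 := by
    refine circleIntegrable_zero_one fun z hz ↦ ?_
    have hrz : ‖(r : ℂ) * z‖ = r := by
      rw [norm_mul, hz, mul_one, Complex.norm_real, norm_of_nonneg hr0.le]
    exact ContinuousAt.comp (f := fun z : ℂ ↦ (r : ℂ) * z)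
      (hd _ (by rwa [hrz]) (by rwa [hrz])).continuousAt
      (continuousAt_const.mul continuousAt_id)
  have i1 := hcont q hq0 le_rfl hqq
  have i2 := hcont q⁻¹ (by positivity) hqq le_rfl
  have i3 : CircleIntegrable (alSalamChiharaWeight q a b) 0 1 :=
    circleIntegrable_zero_one fun z hz ↦ continuousAt_alSalamChiharaWeight hq0 hq1 ha hb hz
  rw [circleAverage_zero_one_congr fun z hz ↦ alSalamChiharaWeight_shift hq0 hq1 ha hb hz]
  have h1 := circleAverage_fun_sub (i3.const_fun_smul (a := 1 - a * b))
    ((i1.fun_sub i2).const_fun_smul (a := a * q))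
  simp only [smul_eq_mul] at h1
  rw [h1, circleAverage_const_mul, circleAverage_const_mul, circleAverage_fun_sub i1 i2, hshift]
  ring

lemma circleAverage_alSalamChiharaWeight_mul_pow {a b : ℂ} (ha : ‖a‖ < 1) (hb : ‖b‖ < 1)
    (k l : ℕ) :
    circleAverage (alSalamChiharaWeight q (a * q ^ (2 * k)) (b * q ^ (2 * l))) 0 1 =
      qpochC q (a * b) (k + l) * circleAverage (alSalamChiharaWeight q a b) 0 1 := by
  have hlt := @norm_mul_q_pow_lt q hq0 hq1
  have left (b : ℂ) (hb : ‖b‖ < 1) (a : ℂ) (ha : ‖a‖ < 1) (k : ℕ) :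
      circleAverage (alSalamChiharaWeight q (a * q ^ (2 * k)) b) 0 1 =
        qpochC q (a * b) k * circleAverage (alSalamChiharaWeight q a b) 0 1 := by
    induction k with
    | zero => simp [qpochC_zero]
    | succ k ih =>
      rw [mul_add, mul_one, pow_add, ← mul_assoc,
        circleAverage_alSalamChiharaWeight_mul_sq hq0 hq1 (hlt ha _) hb, ih, qpochC_succ]
      ring
  have hcomm (a b : ℂ) : alSalamChiharaWeight q a b = alSalamChiharaWeight q b a :=
    funext (alSalamChiharaWeight_comm a b)
  rw [left _ (hlt hb _) _ ha, hcomm, left _ ha _ hb, add_comm k l, qpochC_add, hcomm b a]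
  ring_nf

lemma circleAverage_alSalamChiharaWeight_zero_zero_eq {a : ℂ} (ha : ‖a‖ < 1) :
    circleAverage (alSalamChiharaWeight q 0 0) 0 1 =
      qpochCInf q (a ^ 2) * circleAverage (alSalamChiharaWeight q a a) 0 1 := by
  have hP := continuous_qpochCInf hq0 hq1
  have hlim := tendsto_circleAverage_of_continuousOn (u := fun N ↦ q ^ (2 * N))
    (F := fun t z ↦ alSalamChiharaWeight q (a * t) (a * t) z) (fun t z ht hz ↦ ?_)
    (fun N ↦ ⟨by positivity, pow_le_one₀ hq0.le hq1.le⟩) ?_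
  · simp only [Complex.ofReal_zero, mul_zero, Complex.ofReal_pow] at hlim
    simp_rw [circleAverage_alSalamChiharaWeight_mul_pow hq0 hq1 ha ha, ← two_mul, ← sq] at hlim
    refine tendsto_nhds_unique hlim (Filter.Tendsto.mul_const _ ?_)
    exact (tendsto_qpochC hq0 hq1 _).comp (Filter.tendsto_id.const_mul_atTop' two_pos)
  · have hz0 : z ≠ 0 := norm_ne_zero_iff.1 (by simp [hz])
    have hinv : ContinuousAt (fun p : ℝ × ℂ ↦ p.2⁻¹) (t, z) :=
      ContinuousAt.inv₀ (by fun_prop) hz0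
    have hat : ‖a * t‖ < 1 := by
      rw [norm_mul, Complex.norm_real, norm_of_nonneg ht.1]
      exact (mul_le_of_le_one_right (norm_nonneg _) ht.2).trans_lt ha
    have h1 : ContinuousAt (fun p : ℝ × ℂ ↦ qpochCInf q (a * p.1 * p.2)) (t, z) :=
      hP.continuousAt.comp (f := fun p : ℝ × ℂ ↦ a * p.1 * p.2) (by fun_prop)
    have h2 : ContinuousAt (fun p : ℝ × ℂ ↦ qpochCInf q (a * p.1 * p.2⁻¹)) (t, z) :=
      hP.continuousAt.comp (f := fun p : ℝ × ℂ ↦ a * p.1 * p.2⁻¹) (by fun_prop)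
    refine ContinuousAt.div ?_ (((h1.mul h2).mul h1).mul h2) ?_
    · exact (hP.continuousAt.comp (f := fun p : ℝ × ℂ ↦ p.2 ^ 2) (by fun_prop)).mul
        (hP.continuousAt.comp (f := fun p : ℝ × ℂ ↦ p.2⁻¹ ^ 2) (by fun_prop))
    · have := @qpochCInf_ne_zero q hq0 hq1
      refine mul_ne_zero (mul_ne_zero (mul_ne_zero ?_ ?_) ?_) ?_ <;> apply this <;>
        rw [norm_mul] <;> simpa [hz] using hat
  · exact (tendsto_pow_atTop_nhds_zero_of_lt_one hq0.le hq1).comp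
      (Filter.tendsto_id.const_mul_atTop' two_pos)

end AlSalamChihara

section ThetaConstantTerm

open Real

/-- The function `(z², q²/z²; q²)_∞ / (q²t/z²; q²)_∞`, interpolating between `(z²; q²)_∞` at `t = 1`
and a theta function at `t = 0`. -/
private noncomputable def thetaKernel (q t : ℝ) (z : ℂ) : ℂ :=
  qpochCInf q (z ^ 2) * qpochCInf q (q ^ 2 * z⁻¹ ^ 2) / qpochCInf q (q ^ 2 * t * z⁻¹ ^ 2)

variable {q : ℝ} (hq0 : 0 < q) (hq1 : q < 1)
include hq0 hq1

private lemma norm_theta_arg_lt {t : ℝ} (ht : t ∈ Set.Icc (0 : ℝ) 1) {z : ℂ} (hz : ‖z‖ = 1) :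
    ‖(q : ℂ) ^ 2 * t * z⁻¹ ^ 2‖ < 1 := by
  rw [norm_mul, norm_mul, norm_q_pow hq0, norm_pow, norm_inv, hz, Complex.norm_real,
    norm_of_nonneg ht.1]
  have := pow_lt_one₀ hq0.le hq1 two_ne_zero
  nlinarith [ht.1, ht.2, sq_nonneg q]

private lemma continuousAt_thetaKernel {t : ℝ} {z : ℂ} (ht : t ∈ Set.Icc (0 : ℝ) 1) (hz : ‖z‖ = 1) :
    ContinuousAt (fun p : ℝ × ℂ ↦ thetaKernel q p.1 p.2) (t, z) := by
  have hP := continuous_qpochCInf hq0 hq1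
  have hz0 : z ≠ 0 := norm_ne_zero_iff.1 (by simp [hz])
  have hinv : ContinuousAt (fun p : ℝ × ℂ ↦ p.2⁻¹) (t, z) := ContinuousAt.inv₀ (by fun_prop) hz0
  refine ContinuousAt.div ?_ ?_ ?_
  · exact (hP.continuousAt.comp (f := fun p : ℝ × ℂ ↦ p.2 ^ 2) (by fun_prop)).mul
      (hP.continuousAt.comp (f := fun p : ℝ × ℂ ↦ (q : ℂ) ^ 2 * p.2⁻¹ ^ 2) (by fun_prop))
  · exact hP.continuousAt.comp (f := fun p : ℝ × ℂ ↦ (q : ℂ) ^ 2 * p.1 * p.2⁻¹ ^ 2) (by fun_prop)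
  · exact qpochCInf_ne_zero hq0 hq1 (norm_theta_arg_lt hq0 hq1 ht hz)

private lemma circleIntegrable_thetaKernel {t : ℝ} (ht : t ∈ Set.Icc (0 : ℝ) 1) :
    CircleIntegrable (thetaKernel q t) 0 1 :=
  circleIntegrable_zero_one fun z hz ↦
    ContinuousAt.comp (f := fun z : ℂ ↦ (t, z)) (g := fun p : ℝ × ℂ ↦ thetaKernel q p.1 p.2)
      (continuousAt_thetaKernel hq0 hq1 ht hz) (by fun_prop)

private lemma differentiableAt_thetaKernel {t : ℝ} (ht : t ∈ Set.Icc (0 : ℝ) 1) {z : ℂ}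
    (hz : q ≤ ‖z‖) : DifferentiableAt ℂ (thetaKernel q (q ^ 2 * t)) z := by
  have hP := differentiable_qpochCInf hq0 hq1
  have hzpos : 0 < ‖z‖ := hq0.trans_le hz
  have hz0 : z ≠ 0 := norm_pos_iff.1 hzpos
  have hinv : DifferentiableAt ℂ (fun z : ℂ ↦ z⁻¹) z := differentiableAt_inv hz0
  refine DifferentiableAt.div (((hP _).comp z (by fun_prop)).mul
    (DifferentiableAt.comp (f := fun z : ℂ ↦ (q : ℂ) ^ 2 * z⁻¹ ^ 2) z (hP _) (by fun_prop)))
    (DifferentiableAt.comp (f := fun z : ℂ ↦ (q : ℂ) ^ 2 * (q ^ 2 * t : ℝ) * z⁻¹ ^ 2) z (hP _)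
      (by fun_prop)) (qpochCInf_ne_zero hq0 hq1 ?_)
  have h1 : q * ‖z‖⁻¹ ≤ 1 := by
    rw [← div_eq_mul_inv]
    exact (div_le_one hzpos).2 hz
  have h0 : 0 ≤ q * ‖z‖⁻¹ := by positivity
  rw [norm_mul, norm_mul, norm_q_pow hq0, norm_pow, norm_inv, Complex.norm_real,
    norm_of_nonneg (mul_nonneg (sq_nonneg q) ht.1)]
  calc q ^ 2 * (q ^ 2 * t) * ‖z‖⁻¹ ^ 2 = q ^ 2 * t * (q * ‖z‖⁻¹) ^ 2 := by ring
    _ ≤ q ^ 2 * 1 * 1 := by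
      gcongr
      · exact ht.2
      · exact pow_le_one₀ h0 h1
    _ < 1 := by simpa using pow_lt_one₀ hq0.le hq1 two_ne_zero

private lemma thetaKernel_comp_mul (t : ℝ) {z : ℂ} (hz : z ≠ 0) :
    thetaKernel q (q ^ 2 * t) (q * z) = -z⁻¹ ^ 2 * thetaKernel q t z := by
  have hq : (q : ℂ) ≠ 0 := by exact_mod_cast hq0.ne'
  unfold thetaKernel
  push_cast
  rw [show (q : ℂ) ^ 2 * (q * z)⁻¹ ^ 2 = z⁻¹ ^ 2 by field_simp,
    show (q : ℂ) ^ 2 * (q ^ 2 * t) * (q * z)⁻¹ ^ 2 = q ^ 2 * t * z⁻¹ ^ 2 by field_simp,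
    qpochCInf_eq_one_sub_mul hq0 hq1 (z ^ 2), qpochCInf_eq_one_sub_mul hq0 hq1 (z⁻¹ ^ 2),
    mul_comm (q : ℂ) z, mul_pow, mul_comm ((q : ℂ) ^ 2) (z⁻¹ ^ 2)]
  rw [show -z⁻¹ ^ 2 * ((1 - z ^ 2) * qpochCInf q (z ^ 2 * q ^ 2) * qpochCInf q (z⁻¹ ^ 2 * q ^ 2) /
      qpochCInf q (q ^ 2 * t * z⁻¹ ^ 2)) = -(z⁻¹ ^ 2 * (1 - z ^ 2)) * qpochCInf q (z ^ 2 * q ^ 2) *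
      qpochCInf q (z⁻¹ ^ 2 * q ^ 2) / qpochCInf q (q ^ 2 * t * z⁻¹ ^ 2) by ring,
    show -(z⁻¹ ^ 2 * (1 - z ^ 2)) = 1 - z⁻¹ ^ 2 by field_simp; ring]
  ring

private lemma circleAverage_thetaKernel_comp_mul {t : ℝ} (ht : t ∈ Set.Icc (0 : ℝ) 1) :
    circleAverage (fun z ↦ thetaKernel q (q ^ 2 * t) (q * z)) 0 1 =
      circleAverage (thetaKernel q (q ^ 2 * t)) 0 1 := by
  simpa using circleAverage_comp_mul_eq_of_differentiableAt_annulus hq0 hq1.le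
    fun z hz _ ↦ differentiableAt_thetaKernel hq0 hq1 ht hz

private lemma circleIntegrable_thetaKernel_comp_mul {t : ℝ} (ht : t ∈ Set.Icc (0 : ℝ) 1) :
    CircleIntegrable (fun z ↦ thetaKernel q (q ^ 2 * t) (q * z)) 0 1 :=
  circleIntegrable_zero_one fun z hz ↦
    ContinuousAt.comp (f := fun z : ℂ ↦ (q : ℂ) * z) (differentiableAt_thetaKernel hq0 hq1 ht
      (by rw [norm_mul, hz, mul_one, Complex.norm_real, norm_of_nonneg hq0.le])).continuousAt
      (continuousAt_const.mul continuousAt_id)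

private lemma sq_mul_mem_Icc {t : ℝ} (ht : t ∈ Set.Icc (0 : ℝ) 1) :
    q ^ 2 * t ∈ Set.Icc (0 : ℝ) 1 :=
  ⟨mul_nonneg (sq_nonneg q) ht.1, mul_le_one₀ (pow_le_one₀ hq0.le hq1.le) ht.1 ht.2⟩

private lemma circleAverage_thetaKernel_sq_mul {t : ℝ} (ht : t ∈ Set.Icc (0 : ℝ) 1) :
    (1 - q ^ 2 * t) * circleAverage (thetaKernel q (q ^ 2 * t)) 0 1 =
      circleAverage (thetaKernel q t) 0 1 := by
  have key (z : ℂ) (hz : ‖z‖ = 1) : thetaKernel q t z = thetaKernel q (q ^ 2 * t) z -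
      (q ^ 2 * t : ℂ) • thetaKernel q (q ^ 2 * t) (q * z) := by
    have hz0 : z ≠ 0 := norm_ne_zero_iff.1 (by simp [hz])
    have hlt := norm_theta_arg_lt hq0 hq1 ht hz
    have hn := one_sub_ne_zero_of_norm_lt hlt
    have hne := qpochCInf_ne_zero hq0 hq1 (norm_mul_q_pow_lt hq0 hq1 hlt 2)
    rw [thetaKernel_comp_mul hq0 hq1 t hz0]
    unfold thetaKernel
    push_cast
    rw [qpochCInf_eq_one_sub_mul hq0 hq1 (q ^ 2 * t * z⁻¹ ^ 2),
      show (q : ℂ) ^ 2 * (q ^ 2 * t) * z⁻¹ ^ 2 = q ^ 2 * t * z⁻¹ ^ 2 * q ^ 2 by ring, smul_eq_mul]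
    generalize hs : (q : ℂ) ^ 2 * t * z⁻¹ ^ 2 = s at hn hne ⊢
    generalize qpochCInf q (s * q ^ 2) = D at hne ⊢
    rw [show ∀ x : ℂ, (q : ℂ) ^ 2 * t * (-z⁻¹ ^ 2 * x) = -s * x by intro x; rw [← hs]; ring]
    generalize qpochCInf q (z ^ 2) * qpochCInf q (q ^ 2 * z⁻¹ ^ 2) = A
    field_simp
    ring
  rw [circleAverage_zero_one_congr key,
    circleAverage_fun_sub (circleIntegrable_thetaKernel hq0 hq1 (sq_mul_mem_Icc hq0 hq1 ht))
      (circleIntegrable_thetaKernel_comp_mul hq0 hq1 ht).const_fun_smul, circleAverage_fun_smul,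
    circleAverage_thetaKernel_comp_mul hq0 hq1 ht, smul_eq_mul]
  ring

private lemma circleAverage_thetaKernel_one : circleAverage (thetaKernel q 1) 0 1 = 1 := by
  have hd : Differentiable ℂ fun z : ℂ ↦ qpochCInf q (z ^ 2) :=
    (differentiable_qpochCInf hq0 hq1).comp (by fun_prop)
  rw [circleAverage_zero_one_congr (g := fun z ↦ qpochCInf q (z ^ 2)) fun z hz ↦ ?_,
    hd.diffContOnCl.circleAverage]
  · simp [qpochCInf_zero]
  · have hlt := norm_theta_arg_lt hq0 hq1 (t := 1) (by simp) hz
    have hne := qpochCInf_ne_zero hq0 hq1 hlt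
    rw [Complex.ofReal_one, mul_one] at hne
    rw [thetaKernel, Complex.ofReal_one, mul_one, mul_div_cancel_right₀ _ hne]

private lemma circleAverage_thetaKernel_zero :
    qpochCInf q (q ^ 2) * circleAverage (thetaKernel q 0) 0 1 = 1 := by
  have hmem (N : ℕ) : q ^ (2 * N) ∈ Set.Icc (0 : ℝ) 1 :=
    ⟨by positivity, pow_le_one₀ hq0.le hq1.le⟩
  have hN (N : ℕ) :
      qpochC q (q ^ 2) N * circleAverage (thetaKernel q (q ^ (2 * N))) 0 1 = 1 := by
    induction N with
    | zero => simp [qpochC_zero, circleAverage_thetaKernel_one hq0 hq1]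
    | succ N ih =>
      have h := circleAverage_thetaKernel_sq_mul hq0 hq1 (hmem N)
      rw [← pow_add, show 2 + 2 * N = 2 * (N + 1) by ring] at h
      push_cast at h
      rw [qpochC_succ, mul_assoc, h, ih]
  have hlim := tendsto_circleAverage_of_continuousOn (F := thetaKernel q)
    (fun t z ht hz ↦ continuousAt_thetaKernel hq0 hq1 ht hz) hmem
    ((tendsto_pow_atTop_nhds_zero_of_lt_one hq0.le hq1).comp
      (Filter.tendsto_id.const_mul_atTop' two_pos))
  have h := (tendsto_qpochC hq0 hq1 ((q : ℂ) ^ 2)).mul hlim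
  simp_rw [hN] at h
  exact tendsto_nhds_unique h tendsto_const_nhds

lemma circleAverage_alSalamChiharaWeight_zero_zero :
    qpochCInf q (q ^ 2) * circleAverage (alSalamChiharaWeight q 0 0) 0 1 = 2 := by
  have h0 : (0 : ℝ) ∈ Set.Icc (0 : ℝ) 1 := by simp
  have key (z : ℂ) (hz : ‖z‖ = 1) : alSalamChiharaWeight q 0 0 z =
      thetaKernel q (q ^ 2 * 0) z + thetaKernel q (q ^ 2 * 0) (q * z) := by
    have hz0 : z ≠ 0 := norm_ne_zero_iff.1 (by simp [hz])
    rw [thetaKernel_comp_mul hq0 hq1 0 hz0]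
    simp only [alSalamChiharaWeight, thetaKernel, zero_mul, mul_zero, qpochCInf_zero,
      Complex.ofReal_zero, qpochCInf_eq_one_sub_mul hq0 hq1 (z⁻¹ ^ 2),
      mul_comm ((q : ℂ) ^ 2) (z⁻¹ ^ 2)]
    ring
  rw [circleAverage_zero_one_congr key,
    circleAverage_fun_add (circleIntegrable_thetaKernel hq0 hq1 (sq_mul_mem_Icc hq0 hq1 h0))
      (circleIntegrable_thetaKernel_comp_mul hq0 hq1 h0),
    circleAverage_thetaKernel_comp_mul hq0 hq1 h0, mul_zero, mul_add,
    circleAverage_thetaKernel_zero hq0 hq1]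
  norm_num

lemma circleAverage_alSalamChiharaWeight {a : ℂ} (ha : ‖a‖ < 1) (ha' : ‖a ^ 2‖ < 1) :
    circleAverage (alSalamChiharaWeight q a a) 0 1 =
      2 / (qpochCInf q (q ^ 2) * qpochCInf q (a ^ 2)) := by
  have h1 := qpochCInf_ne_zero hq0 hq1 (norm_q_pow_lt hq0 hq1 two_ne_zero)
  have h2 := qpochCInf_ne_zero hq0 hq1 ha'
  rw [eq_div_iff (mul_ne_zero h1 h2), ← circleAverage_alSalamChiharaWeight_zero_zero hq0 hq1,
    circleAverage_alSalamChiharaWeight_zero_zero_eq hq0 hq1 ha]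
  ring

end ThetaConstantTerm

section TerminatingSum

/-- The coefficient `(q^{-2m}; q²)_l q^{2l} / (q²; q²)_l` of the `q²`-Chu-Vandermonde sum. -/
noncomputable def vandermondeCoeff (q : ℝ) (m l : ℕ) : ℂ :=
  qpochC q (((q : ℂ) ^ (2 * m))⁻¹) l * (q : ℂ) ^ (2 * l) / qpochC q ((q : ℂ) ^ 2) l

variable {q : ℝ} (hq0 : 0 < q) (hq1 : q < 1)

lemma vandermondeCoeff_zero (m : ℕ) : vandermondeCoeff q m 0 = 1 := by
  simp [vandermondeCoeff, qpochC_zero]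

include hq0

lemma vandermondeCoeff_succ_self (m : ℕ) : vandermondeCoeff q m (m + 1) = 0 := by
  have hq : (q : ℂ) ≠ 0 := by exact_mod_cast hq0.ne'
  simp [vandermondeCoeff, qpochC_succ, hq]

lemma qpochC_inv_mul_prod (m : ℕ) :
    qpochC q (((q : ℂ) ^ (2 * m))⁻¹) m * ∏ i ∈ Finset.range m, -(q : ℂ) ^ (2 * (i + 1)) =
      qpochC q ((q : ℂ) ^ 2) m := by
  have hq : (q : ℂ) ≠ 0 := by exact_mod_cast hq0.ne'
  induction m with
  | zero => simp [qpochC_zero]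
  | succ m ih =>
    rw [Finset.prod_range_succ, qpochC_succ', qpochC_succ, ← ih,
      show ((q : ℂ) ^ (2 * (m + 1)))⁻¹ * q ^ 2 = ((q : ℂ) ^ (2 * m))⁻¹ by
        rw [mul_add, pow_add]; field_simp]
    rw [show (q : ℂ) ^ (2 * (m + 1)) = q ^ 2 * q ^ (2 * m) by ring]
    field_simp
    ring

include hq1

lemma vandermondeCoeff_succ_succ (m l : ℕ) :
    vandermondeCoeff q (m + 1) (l + 1) =
      vandermondeCoeff q m (l + 1) - ((q : ℂ) ^ (2 * m))⁻¹ * vandermondeCoeff q m l := by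
  have hq : (q : ℂ) ≠ 0 := by exact_mod_cast hq0.ne'
  have h1 := one_sub_ne_zero_of_norm_lt
    (norm_mul_q_pow_lt hq0 hq1 (norm_q_pow_lt hq0 hq1 two_ne_zero) (2 * l))
  have h2 := qpochC_ne_zero hq0 hq1 (norm_q_pow_lt hq0 hq1 two_ne_zero) l
  unfold vandermondeCoeff
  rw [qpochC_succ' (((q : ℂ) ^ (2 * (m + 1)))⁻¹), qpochC_succ, qpochC_succ,
    show ((q : ℂ) ^ (2 * (m + 1)))⁻¹ * q ^ 2 = ((q : ℂ) ^ (2 * m))⁻¹ by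
      rw [mul_add, pow_add]; field_simp]
  generalize qpochC q ((q : ℂ) ^ (2 * m))⁻¹ l = A
  generalize qpochC q ((q : ℂ) ^ 2) l = B at h2 ⊢
  rw [show (q : ℂ) ^ (2 * (m + 1)) = q ^ 2 * q ^ (2 * m) by ring,
    show (q : ℂ) ^ (2 * (l + 1)) = q ^ 2 * q ^ (2 * l) by ring]
  have hm : (q : ℂ) ^ (2 * m) ≠ 0 := pow_ne_zero _ hq
  generalize (q : ℂ) ^ (2 * m) = M at hm ⊢
  generalize (q : ℂ) ^ (2 * l) = L at h1 ⊢
  field_simp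
  ring

lemma sum_vandermondeCoeff_mul_pow (m : ℕ) (y : ℂ) :
    ∑ l ∈ Finset.range (m + 1), vandermondeCoeff q m l * y ^ l =
      ∏ i ∈ Finset.range m, (1 - ((q : ℂ) ^ (2 * i))⁻¹ * y) := by
  induction m with
  | zero => simp [vandermondeCoeff_zero]
  | succ m ih =>
    have h := Finset.sum_range_succ' (fun l ↦ vandermondeCoeff q m l * y ^ l) (m + 1)
    rw [Finset.sum_range_succ, ih, vandermondeCoeff_succ_self hq0, vandermondeCoeff_zero] at h
    rw [Finset.sum_range_succ', Finset.prod_range_succ, vandermondeCoeff_zero]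
    simp_rw [vandermondeCoeff_succ_succ hq0 hq1, sub_mul]
    rw [Finset.sum_sub_distrib, show ∀ x y z : ℂ, x - y + z = x + z - y by intros; ring, ← h,
      zero_mul, add_zero, mul_sub, mul_one, ← ih, Finset.sum_mul]
    exact congrArg₂ _ rfl (Finset.sum_congr rfl fun l _ ↦ by ring)

lemma sum_vandermondeCoeff_mul_pow_of_lt {m i : ℕ} (hi : i < m) :
    ∑ l ∈ Finset.range (m + 1), vandermondeCoeff q m l * ((q : ℂ) ^ (2 * i)) ^ l = 0 := by
  have hq : (q : ℂ) ≠ 0 := by exact_mod_cast hq0.ne'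
  rw [sum_vandermondeCoeff_mul_pow hq0 hq1]
  exact Finset.prod_eq_zero (Finset.mem_range.2 hi) (by simp [hq])

lemma sum_vandermondeCoeff_mul_pow_self (m : ℕ) :
    ∑ l ∈ Finset.range (m + 1), vandermondeCoeff q m l * ((q : ℂ) ^ (2 * m)) ^ l =
      qpochC q ((q : ℂ) ^ 2) m := by
  have hq : (q : ℂ) ≠ 0 := by exact_mod_cast hq0.ne'
  rw [sum_vandermondeCoeff_mul_pow hq0 hq1, qpochC, ← Finset.prod_range_reflect]
  refine Finset.prod_congr rfl fun i hi ↦ ?_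
  obtain ⟨k, rfl⟩ := Nat.exists_eq_add_of_lt (Finset.mem_range.1 hi)
  rw [show i + k + 1 - 1 - i = k by omega,
    show (q : ℂ) ^ (2 * (i + k + 1)) = q ^ (2 * k) * (q ^ 2 * q ^ (2 * i)) by ring]
  field_simp

open Polynomial in
lemma sum_vandermondeCoeff_mul_eval {m : ℕ} {G : ℂ[X]} (hG : G.natDegree ≤ m) :
    ∑ l ∈ Finset.range (m + 1), vandermondeCoeff q m l * G.eval ((q : ℂ) ^ (2 * l)) =
      G.coeff m * qpochC q ((q : ℂ) ^ 2) m := by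
  simp_rw [eval_eq_sum_range' (Nat.lt_succ_of_le hG), Finset.mul_sum]
  rw [Finset.sum_comm]
  have h (i : ℕ) : ∑ l ∈ Finset.range (m + 1),
      vandermondeCoeff q m l * (G.coeff i * ((q : ℂ) ^ (2 * l)) ^ i) =
      G.coeff i * ∑ l ∈ Finset.range (m + 1),
        vandermondeCoeff q m l * ((q : ℂ) ^ (2 * i)) ^ l := by
    rw [Finset.mul_sum]
    exact Finset.sum_congr rfl fun l _ ↦ by ring
  simp_rw [h]
  rw [Finset.sum_range_succ, sum_vandermondeCoeff_mul_pow_self hq0 hq1, Finset.sum_eq_zero,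
    zero_add]
  intro i hi
  rw [sum_vandermondeCoeff_mul_pow_of_lt hq0 hq1 (Finset.mem_range.1 hi), mul_zero]

open Polynomial in
lemma sum_vandermondeCoeff_mul_qpochC {m j : ℕ} (hj : j ≤ m) (c : ℂ) :
    ∑ l ∈ Finset.range (m + 1), vandermondeCoeff q m l * qpochC q (c * (q : ℂ) ^ (2 * l)) j =
      if j = m then (∏ i ∈ Finset.range m, -(c * (q : ℂ) ^ (2 * i))) * qpochC q ((q : ℂ) ^ 2) m
      else 0 := by
  let G : ℂ[X] := ∏ i ∈ Finset.range j, (C (-(c * (q : ℂ) ^ (2 * i))) * X + C 1)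
  have hdeg : G.natDegree ≤ j := by
    refine (natDegree_prod_le _ _).trans ?_
    refine (Finset.sum_le_sum fun i _ ↦ natDegree_linear_le).trans ?_
    simp
  have heval (l : ℕ) : qpochC q (c * (q : ℂ) ^ (2 * l)) j = G.eval ((q : ℂ) ^ (2 * l)) := by
    simp only [G, qpochC, eval_prod, eval_add, eval_mul, eval_C, eval_X]
    exact Finset.prod_congr rfl fun i _ ↦ by ring
  simp_rw [heval]
  rw [sum_vandermondeCoeff_mul_eval hq0 hq1 (hdeg.trans hj)]
  split_ifs with h
  · subst h
    have hcoeff := coeff_prod_of_natDegree_le (Finset.range j)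
      (fun i ↦ C (-(c * (q : ℂ) ^ (2 * i))) * X + C 1) 1 fun i _ ↦ natDegree_linear_le
    rw [Finset.card_range, mul_one] at hcoeff
    rw [hcoeff]
    simp only [coeff_add, coeff_C_mul, coeff_X_one, mul_one, coeff_C_of_ne_zero one_ne_zero, add_zero]
  · rw [coeff_eq_zero_of_natDegree_lt (hdeg.trans_lt (lt_of_le_of_ne hj h)), zero_mul]

lemma vandermondeCoeff_self_mul_prod (m : ℕ) (c : ℂ) :
    vandermondeCoeff q m m * ∏ i ∈ Finset.range m, -(c * (q : ℂ) ^ (2 * i)) = c ^ m := by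
  have h2 := qpochC_ne_zero hq0 hq1 (norm_q_pow_lt hq0 hq1 two_ne_zero) m
  have h := qpochC_inv_mul_prod hq0 m
  rw [show ∏ i ∈ Finset.range m, -(q : ℂ) ^ (2 * (i + 1)) =
    ∏ i ∈ Finset.range m, (q : ℂ) ^ 2 * -(q : ℂ) ^ (2 * i) from
      Finset.prod_congr rfl fun i _ ↦ by ring, Finset.prod_mul_distrib, Finset.prod_const,
    Finset.card_range] at h
  rw [show ∏ i ∈ Finset.range m, -(c * (q : ℂ) ^ (2 * i)) =
    ∏ i ∈ Finset.range m, c * -(q : ℂ) ^ (2 * i) from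
      Finset.prod_congr rfl fun i _ ↦ by ring, Finset.prod_mul_distrib, Finset.prod_const,
    Finset.card_range, vandermondeCoeff, div_mul_eq_mul_div, div_eq_iff h2, ← h, pow_mul]
  ring

end TerminatingSum

section Orthogonality

open Real

/-- The product `(az; q²)_l (a/z; q²)_l`. -/
noncomputable def askeyWilsonBasis (q : ℝ) (a : ℂ) (l : ℕ) (z : ℂ) : ℂ :=
  qpochC q (a * z) l * qpochC q (a * z⁻¹) l

/-- The Al-Salam–Chihara polynomials with both parameters equal to `a`, as functions of `z`. -/
noncomputable def alSalamChihara (q : ℝ) (a : ℂ) (m : ℕ) (z : ℂ) : ℂ :=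
  ∑ l ∈ Finset.range (m + 1),
    vandermondeCoeff q m l / qpochC q (a ^ 2) l * askeyWilsonBasis q a l z

variable {q : ℝ} (hq0 : 0 < q) (hq1 : q < 1)

lemma askeyWilsonBasis_inv (a : ℂ) (l : ℕ) (z : ℂ) :
    askeyWilsonBasis q a l z⁻¹ = askeyWilsonBasis q a l z := by
  rw [askeyWilsonBasis, askeyWilsonBasis, inv_inv, mul_comm]

lemma alSalamChihara_inv (a : ℂ) (m : ℕ) (z : ℂ) :
    alSalamChihara q a m z⁻¹ = alSalamChihara q a m z := by
  simp_rw [alSalamChihara, askeyWilsonBasis_inv]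

lemma alSalamChiharaWeight_inv (a b z : ℂ) :
    alSalamChiharaWeight q a b z⁻¹ = alSalamChiharaWeight q a b z := by
  simp only [alSalamChiharaWeight, inv_inv]
  ring

lemma continuousAt_askeyWilsonBasis (a : ℂ) (l : ℕ) {z : ℂ} (hz : z ≠ 0) :
    ContinuousAt (askeyWilsonBasis q a l) z := by
  have hinv : ContinuousAt (fun z : ℂ ↦ z⁻¹) z := continuousAt_inv₀ hz
  have hP := continuous_qpochC (q := q) l
  exact (hP.continuousAt.comp (f := fun z : ℂ ↦ a * z) (by fun_prop)).mul
    (hP.continuousAt.comp (f := fun z : ℂ ↦ a * z⁻¹) (by fun_prop))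

lemma continuousAt_alSalamChihara (a : ℂ) (m : ℕ) {z : ℂ} (hz : z ≠ 0) :
    ContinuousAt (alSalamChihara q a m) z :=
  tendsto_finsetSum _ fun l _ ↦
    (continuousAt_askeyWilsonBasis a l hz).const_mul _

include hq0 hq1

lemma askeyWilsonBasis_mul_weight {a z : ℂ} (ha : ‖a‖ < 1) (hz : ‖z‖ = 1) (l j : ℕ) :
    askeyWilsonBasis q a l z * askeyWilsonBasis q a j z * alSalamChiharaWeight q a a z =
      alSalamChiharaWeight q (a * q ^ (2 * l)) (a * q ^ (2 * j)) z := by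
  have h1 : ‖a * z‖ < 1 := by rwa [norm_mul, hz, mul_one]
  have h2 : ‖a * z⁻¹‖ < 1 := by rwa [norm_mul, norm_inv, hz, inv_one, mul_one]
  have key (m : ℕ) : qpochCInf q (a * z) * qpochCInf q (a * z⁻¹) = askeyWilsonBasis q a m z *
      (qpochCInf q (a * q ^ (2 * m) * z) * qpochCInf q (a * q ^ (2 * m) * z⁻¹)) := by
    rw [qpochCInf_eq hq0 hq1 (a * z) m, qpochCInf_eq hq0 hq1 (a * z⁻¹) m, askeyWilsonBasis,
      mul_right_comm a z, mul_right_comm a z⁻¹]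
    ring
  have hb (m : ℕ) : askeyWilsonBasis q a m z ≠ 0 :=
    mul_ne_zero (qpochC_ne_zero hq0 hq1 h1 m) (qpochC_ne_zero hq0 hq1 h2 m)
  unfold alSalamChiharaWeight
  rw [mul_assoc (_ * _) (qpochCInf q (a * z))]
  nth_rewrite 1 [key l]
  rw [key j, mul_mul_mul_comm, mul_div_assoc', mul_div_mul_left _ _ (mul_ne_zero (hb l) (hb j)),
    ← mul_assoc (qpochCInf q (a * _ * z) * qpochCInf q (a * _ * z⁻¹))]

lemma circleIntegrable_mul_alSalamChiharaWeight {a : ℂ} (ha : ‖a‖ < 1) {f g : ℂ → ℂ}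
    (hf : ∀ z ≠ 0, ContinuousAt f z) (hg : ∀ z ≠ 0, ContinuousAt g z) :
    CircleIntegrable (fun z ↦ f z * g z * alSalamChiharaWeight q a a z) 0 1 :=
  circleIntegrable_zero_one fun z hz ↦ by
    have hz0 : z ≠ 0 := norm_ne_zero_iff.1 (by simp [hz])
    exact ((hf z hz0).mul (hg z hz0)).mul (continuousAt_alSalamChiharaWeight hq0 hq1 ha ha hz)

lemma circleAverage_sum_mul {ι : Type*} (s : Finset ι) (c : ι → ℂ) {a : ℂ} (ha : ‖a‖ < 1)
    {f : ι → ℂ → ℂ} {g : ℂ → ℂ} (hf : ∀ i, ∀ z ≠ 0, ContinuousAt (f i) z)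
    (hg : ∀ z ≠ 0, ContinuousAt g z) :
    circleAverage (fun z ↦ (∑ i ∈ s, c i * f i z) * g z * alSalamChiharaWeight q a a z) 0 1 =
      ∑ i ∈ s, c i * circleAverage (fun z ↦ f i z * g z * alSalamChiharaWeight q a a z) 0 1 := by
  have h := circleAverage_fun_sum fun i (_ : i ∈ s) ↦
    (circleIntegrable_mul_alSalamChiharaWeight hq0 hq1 ha (hf i) hg).const_fun_smul (a := c i)
  simp_rw [smul_eq_mul, circleAverage_const_mul] at h
  rw [← h]
  simp_rw [Finset.sum_mul, mul_assoc]

variable {a : ℂ} (ha : ‖a‖ < 1) (ha' : ‖a ^ 2‖ < 1)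
include ha ha'

lemma circleAverage_alSalamChihara_mul_basis {m j : ℕ} (hj : j ≤ m) :
    circleAverage (fun z ↦ alSalamChihara q a m z * askeyWilsonBasis q a j z *
      alSalamChiharaWeight q a a z) 0 1 =
      if j = m then circleAverage (alSalamChiharaWeight q a a) 0 1 *
        (∏ i ∈ Finset.range m, -(a ^ 2 * (q : ℂ) ^ (2 * i))) * qpochC q ((q : ℂ) ^ 2) m
      else 0 := by
  have h (l : ℕ) : vandermondeCoeff q m l / qpochC q (a ^ 2) l *
      circleAverage (fun z ↦ askeyWilsonBasis q a l z * askeyWilsonBasis q a j z *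
        alSalamChiharaWeight q a a z) 0 1 =
      circleAverage (alSalamChiharaWeight q a a) 0 1 *
        (vandermondeCoeff q m l * qpochC q (a ^ 2 * (q : ℂ) ^ (2 * l)) j) := by
    have hne := qpochC_ne_zero hq0 hq1 ha' l
    rw [circleAverage_zero_one_congr fun z hz ↦ askeyWilsonBasis_mul_weight hq0 hq1 ha hz l j,
      circleAverage_alSalamChiharaWeight_mul_pow hq0 hq1 ha ha, ← sq, qpochC_add]
    field_simp
  simp_rw [alSalamChihara]
  rw [circleAverage_sum_mul hq0 hq1 _ _ ha (fun l _ ↦ continuousAt_askeyWilsonBasis a l)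
    fun _ ↦ continuousAt_askeyWilsonBasis a j]
  simp_rw [h]
  rw [← Finset.mul_sum, sum_vandermondeCoeff_mul_qpochC hq0 hq1 hj]
  split_ifs <;> ring

lemma circleAverage_alSalamChihara_mul_of_le {m k : ℕ} (hk : k ≤ m) :
    circleAverage (fun z ↦ alSalamChihara q a k z * alSalamChihara q a m z *
      alSalamChiharaWeight q a a z) 0 1 =
      if k = m then circleAverage (alSalamChiharaWeight q a a) 0 1 *
        ((a ^ 2) ^ m * qpochC q ((q : ℂ) ^ 2) m / qpochC q (a ^ 2) m)
      else 0 := by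
  have h {j : ℕ} (hj : j ≤ m) := circleAverage_alSalamChihara_mul_basis hq0 hq1 ha ha' hj
  simp_rw [mul_comm (alSalamChihara q a m _) (askeyWilsonBasis _ _ _ _)] at h
  conv_lhs => enter [1, z, 1, 1]; rw [alSalamChihara]
  rw [circleAverage_sum_mul hq0 hq1 _ _ ha (fun l _ ↦ continuousAt_askeyWilsonBasis a l)
    fun _ ↦ continuousAt_alSalamChihara a m]
  rw [Finset.sum_range_succ, Finset.sum_eq_zero, zero_add, h hk]
  · split_ifs with hkm
    · subst hkm
      rw [← vandermondeCoeff_self_mul_prod hq0 hq1 k (a ^ 2)]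
      ring
    · rw [mul_zero]
  · intro j hj
    have hjk := Finset.mem_range.1 hj
    rw [h (hjk.le.trans hk), if_neg (by omega), mul_zero]

/-- Orthogonality of the Al-Salam–Chihara polynomials. -/
theorem circleAverage_alSalamChihara_mul (k m : ℕ) :
    circleAverage (fun z ↦ alSalamChihara q a k z * alSalamChihara q a m z *
      alSalamChiharaWeight q a a z) 0 1 =
      if k = m then circleAverage (alSalamChiharaWeight q a a) 0 1 *
        ((a ^ 2) ^ m * qpochC q ((q : ℂ) ^ 2) m / qpochC q (a ^ 2) m)
      else 0 := by
  rcases le_total k m with h | h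
  · exact circleAverage_alSalamChihara_mul_of_le hq0 hq1 ha ha' h
  · simp_rw [mul_comm (alSalamChihara q a k _)]
    rw [circleAverage_alSalamChihara_mul_of_le hq0 hq1 ha ha' h]
    by_cases hkm : k = m
    · simp [hkm]
    · rw [if_neg hkm, if_neg (Ne.symm hkm)]

theorem circleAverage_sum_alSalamChihara_mul_sum (s : Finset ℕ) (c d : ℕ → ℂ) :
    circleAverage (fun z ↦ (∑ k ∈ s, c k * alSalamChihara q a k z) *
      (∑ k ∈ s, d k * alSalamChihara q a k z) * alSalamChiharaWeight q a a z) 0 1 =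
      ∑ k ∈ s, c k * d k * (circleAverage (alSalamChiharaWeight q a a) 0 1 *
        ((a ^ 2) ^ k * qpochC q ((q : ℂ) ^ 2) k / qpochC q (a ^ 2) k)) := by
  have hcont (k : ℕ) (z : ℂ) (hz : z ≠ 0) := continuousAt_alSalamChihara (q := q) a k hz
  rw [circleAverage_sum_mul hq0 hq1 _ _ ha hcont fun z hz ↦
    tendsto_finsetSum _ fun k _ ↦ (hcont k z hz).const_mul _]
  refine Finset.sum_congr rfl fun k hk ↦ ?_
  simp_rw [mul_comm (alSalamChihara q a k _)]
  rw [circleAverage_sum_mul hq0 hq1 _ _ ha hcont (hcont k)]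
  simp_rw [circleAverage_alSalamChihara_mul hq0 hq1 ha ha']
  rw [Finset.sum_eq_single k (fun j _ hj ↦ by rw [if_neg hj, mul_zero]) (absurd hk), if_pos rfl]
  ring

end Orthogonality

section Plancherel

open Real

lemma integral_circleMap_half_period {G : ℂ → ℂ} (hG : CircleIntegrable G 0 1)
    (hinv : ∀ z, G z⁻¹ = G z) {b : ℝ} (hb : b ≠ 0) :
    ∫ ρ in (0 : ℝ)..(π / b), G (circleMap 0 1 (ρ * -b)) = (π / b : ℝ) * circleAverage G 0 1 := by
  have heven (θ : ℝ) : G (circleMap 0 1 (-θ)) = G (circleMap 0 1 θ) := by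
    rw [← hinv (circleMap 0 1 θ), circleMap_zero_inv, inv_one]
  have hper : Function.Periodic (fun θ ↦ G (circleMap 0 1 θ)) (2 * π) := fun θ ↦ by
    simp [periodic_circleMap 0 1 θ]
  have hsub : Set.uIcc 0 π ⊆ Set.uIcc 0 (2 * π) ∧ Set.uIcc π (2 * π) ⊆ Set.uIcc 0 (2 * π) := by
    have := pi_pos
    rw [Set.uIcc_of_le (by linarith), Set.uIcc_of_le (by linarith), Set.uIcc_of_le (by linarith)]
    exact ⟨Set.Icc_subset_Icc_right (by linarith), Set.Icc_subset_Icc_left (by linarith)⟩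
  have hint : IntervalIntegrable (fun θ ↦ G (circleMap 0 1 θ)) MeasureTheory.volume 0 (2 * π) := hG
  have hhalf : ∫ θ in π..(2 * π), G (circleMap 0 1 θ) = ∫ θ in (0 : ℝ)..π, G (circleMap 0 1 θ) := by
    have h := intervalIntegral.integral_comp_sub_left (a := 0) (b := π)
      (fun θ ↦ G (circleMap 0 1 θ)) (2 * π)
    rw [sub_zero, show 2 * π - π = π by ring] at h
    rw [← h]
    refine intervalIntegral.integral_congr fun θ _ ↦ ?_
    exact neg_add_eq_sub θ (2 * π) ▸ (hper (-θ)).trans (heven θ)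
  simp_rw [mul_neg, heven]
  rw [intervalIntegral.integral_comp_mul_right (fun θ ↦ G (circleMap 0 1 θ)) hb, zero_mul,
    div_mul_cancel₀ _ hb, circleAverage_def,
    ← intervalIntegral.integral_add_adjacent_intervals (hint.mono_set hsub.1)
      (hint.mono_set hsub.2), hhalf, ← two_mul, Complex.real_smul, Complex.real_smul]
  have hpi : (π : ℂ) ≠ 0 := by exact_mod_cast pi_ne_zero
  have hb' : (b : ℂ) ≠ 0 := by exact_mod_cast hb
  push_cast
  field_simp

/-- The weight `q^{-2nk} (q^{2k+2}; q²)_{n-1}` of the `q`-spherical transform. -/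
noncomputable def sphWeight (q : ℝ) (n k : ℕ) : ℂ :=
  ((q : ℂ) ^ (2 * n * k))⁻¹ * qpochC q ((q : ℂ) ^ (2 * k + 2)) (n - 1)

variable {q : ℝ} (hq0 : 0 < q) (hq1 : q < 1) {n : ℕ}

lemma conj_sphWeight (k : ℕ) : (starRingEnd ℂ) (sphWeight q n k) = sphWeight q n k := by
  simp [sphWeight, qpochC_conj]

lemma conj_alSalamChihara (m : ℕ) {z : ℂ} (hz : ‖z‖ = 1) :
    (starRingEnd ℂ) (alSalamChihara q (q ^ n) m z) = alSalamChihara q (q ^ n) m z := by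
  conv_rhs => rw [← alSalamChihara_inv]
  simp [alSalamChihara, askeyWilsonBasis, vandermondeCoeff, qpochC_conj,
    ← Complex.inv_eq_conj hz]

lemma qcpow_eq_circleMap (q ρ : ℝ) : qcpow q (ρ * Complex.I) = circleMap 0 1 (ρ * log q) := by
  simp only [qcpow, circleMap, zero_add, Complex.ofReal_one, one_mul]
  push_cast
  ring_nf

lemma qcpow_two_mul (q ρ : ℝ) :
    qcpow q (2 * ρ * Complex.I) = circleMap 0 1 (ρ * log q) ^ 2 := by
  rw [← qcpow_eq_circleMap, qcpow, qcpow, ← Complex.exp_nat_mul]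
  push_cast
  ring_nf

lemma qcpow_neg (q : ℝ) (w : ℂ) : qcpow q (-w) = (qcpow q w)⁻¹ := by
  rw [qcpow, qcpow, ← Complex.exp_neg, neg_mul]

include hq0

lemma qcpow_natCast_add (n : ℕ) (w : ℂ) : qcpow q (n + w) = q ^ n * qcpow q w := by
  rw [qcpow, qcpow, add_mul, Complex.exp_add, Complex.exp_nat_mul, ← Complex.ofReal_exp,
    exp_log hq0]

lemma sphPhi_eq (ρ : ℝ) (m : ℕ) :
    sphPhi q n ρ m = alSalamChihara q (q ^ n) m (circleMap 0 1 (ρ * log q)) := by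
  simp only [sphPhi, alSalamChihara, vandermondeCoeff, askeyWilsonBasis]
  refine Finset.sum_congr rfl fun l _ ↦ ?_
  rw [sub_eq_add_neg, qcpow_natCast_add hq0, qcpow_natCast_add hq0, qcpow_neg,
    qcpow_eq_circleMap, ← pow_mul, mul_comm n 2]
  ring

lemma cInv_eq (ρ : ℝ) :
    cInv q n ρ = qpochCInf q ((q : ℂ) ^ (2 * n)) ^ 2 *
      alSalamChiharaWeight q (q ^ n) (q ^ n) (circleMap 0 1 (ρ * log q)) := by
  rw [cInv, sub_eq_add_neg, qcpow_natCast_add hq0, qcpow_natCast_add hq0, qcpow_neg, qcpow_neg,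
    qcpow_eq_circleMap, qcpow_two_mul, alSalamChiharaWeight, inv_pow]
  ring

lemma sphT_eq {f : ℕ → ℂ} (hf : (Function.support f).Finite) (ρ : ℝ) :
    sphT q n f ρ = ∑ k ∈ hf.toFinset, (1 - (q : ℂ) ^ (2 * n)) * (f k * sphWeight q n k) *
      alSalamChihara q (q ^ n) k (circleMap 0 1 (ρ * log q)) := by
  rw [sphT, tsum_eq_sum (s := hf.toFinset), Finset.mul_sum]
  · refine Finset.sum_congr rfl fun k _ ↦ ?_
    rw [sphPhi_eq hq0, sphWeight]
    ring
  · intro k hk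
    have : f k = 0 := by simpa using hk
    simp [this]

lemma norm_sphT_sq {f : ℕ → ℂ} (hf : (Function.support f).Finite) (ρ : ℝ) :
    (‖sphT q n f ρ‖ : ℂ) ^ 2 =
      (∑ k ∈ hf.toFinset, (1 - (q : ℂ) ^ (2 * n)) * (f k * sphWeight q n k) *
        alSalamChihara q (q ^ n) k (circleMap 0 1 (ρ * log q))) *
      ∑ k ∈ hf.toFinset, (1 - (q : ℂ) ^ (2 * n)) * ((starRingEnd ℂ) (f k) * sphWeight q n k) *
        alSalamChihara q (q ^ n) k (circleMap 0 1 (ρ * log q)) := by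
  rw [← Complex.mul_conj', sphT_eq hq0 hf, map_sum]
  simp [conj_alSalamChihara, conj_sphWeight]

include hq1

lemma circleAverage_weight_mul_sphWeight (hn : 1 ≤ n) (k : ℕ) :
    qpochCInf q ((q : ℂ) ^ (2 * n)) ^ 2 *
      (circleAverage (alSalamChiharaWeight q (q ^ n) (q ^ n)) 0 1 *
        ((((q : ℂ) ^ n) ^ 2) ^ k * qpochC q ((q : ℂ) ^ 2) k / qpochC q (((q : ℂ) ^ n) ^ 2) k)) *
      sphWeight q n k = 2 := by
  have hq : (q : ℂ) ≠ 0 := by exact_mod_cast hq0.ne'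
  have hsq : ((q : ℂ) ^ n) ^ 2 = q ^ (2 * n) := by rw [← pow_mul, mul_comm]
  have hlt : ‖((q : ℂ) ^ n) ^ 2‖ < 1 := hsq ▸ norm_q_pow_lt hq0 hq1 (by omega)
  have hC := qpochC_ne_zero hq0 hq1 hlt k
  have hCinf := qpochCInf_ne_zero hq0 hq1 (norm_mul_q_pow_lt hq0 hq1 hlt (2 * k))
  have hp := qpochC_ne_zero hq0 hq1 (norm_q_pow_lt hq0 hq1 two_ne_zero) k
  have hp' := qpochC_ne_zero hq0 hq1 (norm_q_pow_lt hq0 hq1 (k := 2 * k + 2) (by omega)) (n - 1)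
  rw [circleAverage_alSalamChiharaWeight hq0 hq1 (norm_q_pow_lt hq0 hq1 (by omega)) hlt,
    sphWeight, ← hsq, qpochCInf_eq hq0 hq1 (((q : ℂ) ^ n) ^ 2) k,
    qpochCInf_eq hq0 hq1 ((q : ℂ) ^ 2) (k + (n - 1)), qpochC_add,
    show (q : ℂ) ^ 2 * q ^ (2 * k) = q ^ (2 * k + 2) by ring,
    show (q : ℂ) ^ 2 * q ^ (2 * (k + (n - 1))) = (q ^ n) ^ 2 * q ^ (2 * k) by
      obtain ⟨m, rfl⟩ := Nat.exists_eq_add_of_le hn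
      rw [Nat.add_sub_cancel_left]
      ring,
    show (q : ℂ) ^ (2 * n * k) = ((q ^ n) ^ 2) ^ k by rw [hsq, pow_mul]]
  have hM : (((q : ℂ) ^ n) ^ 2) ^ k ≠ 0 := by positivity
  generalize qpochCInf q (((q : ℂ) ^ n) ^ 2 * q ^ (2 * k)) = X1 at *
  generalize qpochC q (((q : ℂ) ^ n) ^ 2) k = X2 at *
  generalize qpochC q ((q : ℂ) ^ 2) k = X3 at *
  generalize qpochC q ((q : ℂ) ^ (2 * k + 2)) (n - 1) = X4 at *
  generalize (((q : ℂ) ^ n) ^ 2) ^ k = X5 at *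
  field_simp

end Plancherel

/-- The Plancherel formula for the q-spherical transform: for finitely supported `f`,
`(1 − q^{2n}) Σ_k |f(q^{2k})|² q^{−2nk} (q^{2k+2};q²)_{n−1}
  = [h/(4π(1−q^{2n}))] ∫_0^{2π/h} |𝓕f(ρ)|² dρ/|c(ρ)|²`, where `h = log q^{−2}`. -/
theorem statement7 (q : ℝ) (hq0 : 0 < q) (hq1 : q < 1) (n : ℕ) (hn : 1 ≤ n)
    (f : ℕ → ℂ) (hf : (Function.support f).Finite) :
    (1 - (q : ℂ) ^ (2 * n)) *
      ∑' k : ℕ, ((‖f k‖ : ℂ)) ^ 2 * ((q : ℂ) ^ (2 * n * k))⁻¹ *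
        qpochC q ((q : ℂ) ^ (2 * k + 2)) (n - 1) =
    ((Real.log ((q ^ 2)⁻¹) / (4 * Real.pi * (1 - q ^ (2 * n))) : ℝ) : ℂ) *
      ∫ ρ in (0 : ℝ)..(2 * Real.pi / Real.log ((q ^ 2)⁻¹)),
        ((‖sphT q n f ρ‖ : ℂ)) ^ 2 * cInv q n ρ := by
  have hlog : -Real.log q ≠ 0 := neg_ne_zero.2 (Real.log_neg hq0 hq1).ne
  have hh : Real.log ((q ^ 2)⁻¹) = 2 * -Real.log q := by
    rw [Real.log_inv, Real.log_pow]
    push_cast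
    ring
  have hn0 : 1 - (q : ℂ) ^ (2 * n) ≠ 0 :=
    one_sub_ne_zero_of_norm_lt (norm_q_pow_lt hq0 hq1 (by omega))
  have ha : ‖(q : ℂ) ^ n‖ < 1 := norm_q_pow_lt hq0 hq1 (by omega)
  have ha' : ‖((q : ℂ) ^ n) ^ 2‖ < 1 := by
    rw [← pow_mul]
    exact norm_q_pow_lt hq0 hq1 (by omega)
  let S (g : ℕ → ℂ) (z : ℂ) : ℂ := ∑ k ∈ hf.toFinset,
    (1 - (q : ℂ) ^ (2 * n)) * (g k * sphWeight q n k) * alSalamChihara q (q ^ n) k z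
  let f' (k : ℕ) : ℂ := (starRingEnd ℂ) (f k)
  let G (z : ℂ) : ℂ := S f z * S f' z * alSalamChiharaWeight q (q ^ n) (q ^ n) z
  have hS (g : ℕ → ℂ) (z : ℂ) (hz : z ≠ 0) : ContinuousAt (S g) z :=
    tendsto_finsetSum _ fun k _ ↦ (continuousAt_alSalamChihara _ k hz).const_mul _
  have hG : CircleIntegrable G 0 1 :=
    circleIntegrable_mul_alSalamChiharaWeight hq0 hq1 ha (hS f) (hS f')
  have hinv (z : ℂ) : G z⁻¹ = G z := by
    simp only [G, S, alSalamChihara_inv, alSalamChiharaWeight_inv]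
  have hintegral := integral_circleMap_half_period hG hinv hlog
  rw [circleAverage_sum_alSalamChihara_mul_sum hq0 hq1 ha ha', neg_neg] at hintegral
  have hintegrand (ρ : ℝ) : (‖sphT q n f ρ‖ : ℂ) ^ 2 * cInv q n ρ =
      qpochCInf q ((q : ℂ) ^ (2 * n)) ^ 2 * G (circleMap 0 1 (ρ * Real.log q)) := by
    rw [norm_sphT_sq hq0 hf, cInv_eq hq0]
    simp only [G, S, f']
    ring
  simp_rw [hintegrand]
  rw [intervalIntegral.integral_const_mul, hh, mul_div_mul_left _ _ two_ne_zero, hintegral,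
    tsum_eq_sum (s := hf.toFinset) fun k hk ↦ by
      have : f k = 0 := by simpa using hk
      simp [this], Finset.mul_sum, Finset.mul_sum, Finset.mul_sum, Finset.mul_sum]
  refine Finset.sum_congr rfl fun k _ ↦ ?_
  rw [← Complex.mul_conj', mul_assoc (f k * _), ← sphWeight]
  have hpi : (Real.pi : ℂ) ≠ 0 := by exact_mod_cast Real.pi_ne_zero
  have hlog' : (Real.log q : ℂ) ≠ 0 := by exact_mod_cast neg_ne_zero.1 hlog
  have hw := circleAverage_weight_mul_sphWeight hq0 hq1 hn k
  generalize Real.circleAverage (alSalamChiharaWeight q (q ^ n) (q ^ n)) 0 1 *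
    ((((q : ℂ) ^ n) ^ 2) ^ k * qpochC q ((q : ℂ) ^ 2) k / qpochC q (((q : ℂ) ^ n) ^ 2) k) = N at hw ⊢
  push_cast
  calc _ = (1 - (q : ℂ) ^ (2 * n)) * (f k * f' k * sphWeight q n k) *
        (qpochCInf q ((q : ℂ) ^ (2 * n)) ^ 2 * N * sphWeight q n k) / 2 := by rw [hw]; simp only [f']; ring
    _ = _ := by field_simp; ring
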